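/- arXiv:2306.15239 — 2 statements merged into one kernel-verified Lean document; each statement's English description precedes it below -/
import Mathlib

section
/- Let d ∈ ℕ, 0 < p ≤ u < ∞, 0 < v ≤ p and 0 < R < ∞. Then there exists a constant c > 0, depending only on d, p, u, v, R, such that for every F ∈ M^u_p(ℝ^d): ‖(∫_{B(·,R)} |F(x)|^v dx)^{1/v} | M^u_p(ℝ^d)‖ ≤ c · ‖F | M^u_p(ℝ^d)‖. -/
open MeasureTheory ENNReal Set Metric Filter
open scoped NNReal Topology

noncomputable section

abbrev Euc (d : ℕ) : Type := EuclideanSpace ℝ (Fin d)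

/-- Morrey quasi-norm of an `ℝ≥0∞`-valued function on a set `Ω ⊆ ℝ^d`. -/
noncomputable def morreyNormE (d : ℕ) (p u : ℝ) (Ω : Set (Euc d)) (g : Euc d → ℝ≥0∞) : ℝ≥0∞ :=
  ⨆ (y : Euc d) (_ : y ∈ Ω) (r : ℝ) (_ : 0 < r),
    ENNReal.ofReal (r ^ ((d : ℝ) * (1 / u - 1 / p))) *
      (∫⁻ x in Ω ∩ Metric.ball y r, g x ^ p) ^ (1 / p)

/-- Morrey quasi-norm of a complex-valued function on `Ω ⊆ ℝ^d`. -/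
noncomputable def morreyNorm (d : ℕ) (p u : ℝ) (Ω : Set (Euc d)) (f : Euc d → ℂ) : ℝ≥0∞ :=
  morreyNormE d p u Ω fun x => (‖f x‖₊ : ℝ≥0∞)

/-- The set of (functions induced by) complex polynomials in `d` variables of
total degree at most `N - 1`, i.e. of total degree `< N`. -/
def polyFuns (d N : ℕ) : Set (Euc d → ℂ) :=
  {P | ∃ Q : MvPolynomial (Fin d) ℂ, Q.totalDegree < N ∧
        ∀ x : Euc d, P x = MvPolynomial.eval (fun i => ((x i : ℝ) : ℂ)) Q}

/-- Local oscillation `osc_{v,Ω}^{N-1} f (x, t)`. -/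
noncomputable def osc (d N : ℕ) (v : ℝ) (Ω : Set (Euc d)) (f : Euc d → ℂ)
    (x : Euc d) (t : ℝ) : ℝ≥0∞ :=
  ⨅ (P : Euc d → ℂ) (_ : P ∈ polyFuns d N),
    (ENNReal.ofReal (t ^ (-(d : ℝ))) *
      ∫⁻ y in Metric.ball x t ∩ Ω, (‖f y - P y‖₊ : ℝ≥0∞) ^ v) ^ (1 / v)

/-- `f` is locally `v`-integrable on `Ω`. -/
def MemLvLoc (d : ℕ) (v : ℝ) (Ω : Set (Euc d)) (f : Euc d → ℂ) : Prop :=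
  AEMeasurable f (volume.restrict Ω) ∧
    ∀ K : Set (Euc d), IsCompact K → K ⊆ Ω → (∫⁻ y in K, (‖f y‖₊ : ℝ≥0∞) ^ v) < ⊤

/-- The `N`-th order difference `Δ_h^N f (x)`. -/
noncomputable def deltaN (d N : ℕ) (f : Euc d → ℂ) (h x : Euc d) : ℂ :=
  ∑ k ∈ Finset.range (N + 1), (-1 : ℂ) ^ (N - k) * (N.choose k : ℂ) * f (x + (k : ℝ) • h)

/-- The set `V^N(x,t)` of admissible difference steps. -/
def VN (d N : ℕ) (Ω : Set (Euc d)) (x : Euc d) (t : ℝ) : Set (Euc d) :=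
  {h | ‖h‖ < t ∧ ∀ ℓ : ℕ, ℓ ≤ N → x + (ℓ : ℝ) • h ∈ Ω}

/-- The Hardy–Littlewood maximal function. -/
noncomputable def hlMaximal (d : ℕ) (f : Euc d → ℂ) (x : Euc d) : ℝ≥0∞ :=
  ⨆ (r : ℝ) (_ : 0 < r),
    (volume (Metric.ball x r))⁻¹ * ∫⁻ y in Metric.ball x r, (‖f y‖₊ : ℝ≥0∞)

/-- The inner product `⟨f,g⟩_{x,t} = t^{-d} ∫_{B(x,t) ∩ Ω} f(z) conj(g(z)) dz`. -/
noncomputable def innerXT (d : ℕ) (Ω : Set (Euc d)) (x : Euc d) (t : ℝ)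
    (f g : Euc d → ℂ) : ℂ :=
  ((t ^ (-(d : ℝ)) : ℝ) : ℂ) * ∫ z in Metric.ball x t ∩ Ω, f z * (starRingEnd ℂ) (g z)

theorem lintegral_ball_eq_lintegral_ball_zero_add {E : Type*} [NormedAddCommGroup E]
    [MeasurableSpace E] [BorelSpace E] (μ : Measure E) [μ.IsAddLeftInvariant]
    {h : E → ℝ≥0∞} (hh : Measurable h) (a x : E) (R : ℝ) :
    ∫⁻ z in ball (x + a) R, h z ∂μ = ∫⁻ z in ball a R, h (x + z) ∂μ := by
  have hpre : (fun z => x + z) ⁻¹' ball (x + a) R = ball a R := by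
    ext z
    simp [mem_ball]
  rw [← (measurePreserving_add_left μ x).setLIntegral_comp_preimage measurableSet_ball hh, hpre]

/-- Jensen's inequality for the `v`-mean and the `p`-mean, `v ≤ p`, without normalization. -/
theorem lintegral_rpow_rpow_le_measure_univ_mul {α : Type*} [MeasurableSpace α] {μ : Measure α}
    {g : α → ℝ≥0∞} (hg : AEMeasurable g μ) {v p : ℝ} (hv : 0 < v) (hvp : v ≤ p) :
    (∫⁻ a, g a ^ v ∂μ) ^ (1 / v) ≤
      (∫⁻ a, g a ^ p ∂μ) ^ (1 / p) * μ univ ^ (1 / v - 1 / p) := by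
  simpa [eLpNorm', enorm_eq_self] using
    eLpNorm'_le_eLpNorm'_mul_rpow_measure_univ hv hvp hg.aestronglyMeasurable

theorem lintegral_ball_rpow_le_morreyNormE_rpow (d : ℕ) {p : ℝ} (u : ℝ) (hp : 0 < p)
    (g : Euc d → ℝ≥0∞) (y : Euc d) {r : ℝ} (hr : 0 < r) :
    ENNReal.ofReal (r ^ ((d : ℝ) * (1 / u - 1 / p))) ^ p * ∫⁻ x in ball y r, g x ^ p ≤
      morreyNormE d p u univ g ^ p := by
  have h : ENNReal.ofReal (r ^ ((d : ℝ) * (1 / u - 1 / p))) *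
      (∫⁻ x in univ ∩ ball y r, g x ^ p) ^ (1 / p) ≤ morreyNormE d p u univ g :=
    le_iSup₂_of_le y (mem_univ y) (le_iSup₂_of_le r hr le_rfl)
  have h' := ENNReal.rpow_le_rpow h hp.le
  rwa [ENNReal.mul_rpow_of_nonneg _ _ hp.le, ← ENNReal.rpow_mul, one_div_mul_cancel hp.ne',
    ENNReal.rpow_one, univ_inter] at h'

theorem morreyNormE_ball_mean_le (d : ℕ) {p u v : ℝ} (R : ℝ) (hv : 0 < v) (hvp : v ≤ p)
    {g : Euc d → ℝ≥0∞} (hg : Measurable g) :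
    morreyNormE d p u univ (fun x => (∫⁻ y in ball x R, g y ^ v) ^ (1 / v)) ≤
      volume (ball (0 : Euc d) R) ^ (1 / v) * morreyNormE d p u univ g := by
  have hp : 0 < p := hv.trans_le hvp
  have hgp : Measurable fun x => g x ^ p := hg.pow_const p
  set V := volume (ball (0 : Euc d) R) with hV
  set N := morreyNormE d p u univ g with hN
  refine iSup₂_le fun y _ => iSup₂_le fun r hr => ?_
  set w := ENNReal.ofReal (r ^ ((d : ℝ) * (1 / u - 1 / p))) with hw
  have hpt (x : Euc d) : ((∫⁻ y in ball x R, g y ^ v) ^ (1 / v)) ^ p ≤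
      (V ^ (1 / v - 1 / p)) ^ p * ∫⁻ z in ball 0 R, g (x + z) ^ p := by
    have h := lintegral_rpow_rpow_le_measure_univ_mul (μ := volume.restrict (ball x R))
      hg.aemeasurable hv hvp
    rw [Measure.restrict_apply_univ, Measure.addHaar_ball_center, ← hV] at h
    refine (ENNReal.rpow_le_rpow h hp.le).trans_eq ?_
    rw [ENNReal.mul_rpow_of_nonneg _ _ hp.le, ← ENNReal.rpow_mul _ (1 / p),
      one_div_mul_cancel hp.ne', ENNReal.rpow_one, mul_comm]
    congr 1
    simpa using lintegral_ball_eq_lintegral_ball_zero_add volume hgp 0 x R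
  have hmeas : Measurable fun q : Euc d × Euc d => g (q.1 + q.2) ^ p :=
    hgp.comp (measurable_fst.add measurable_snd)
  have hball (z : Euc d) : ∫⁻ x in ball y r, g (x + z) ^ p = ∫⁻ x in ball (z + y) r, g x ^ p := by
    rw [lintegral_ball_eq_lintegral_ball_zero_add volume hgp]
    simp only [add_comm]
  have key : w ^ p * ∫⁻ x in ball y r, ((∫⁻ y in ball x R, g y ^ v) ^ (1 / v)) ^ p ≤
      (V ^ (1 / v) * N) ^ p := by
    calc w ^ p * ∫⁻ x in ball y r, ((∫⁻ y in ball x R, g y ^ v) ^ (1 / v)) ^ p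
      _ ≤ w ^ p * ∫⁻ x in ball y r,
            (V ^ (1 / v - 1 / p)) ^ p * ∫⁻ z in ball 0 R, g (x + z) ^ p := by
          gcongr with x
          exact hpt x
      _ = (V ^ (1 / v - 1 / p)) ^ p *
            ∫⁻ z in ball (0 : Euc d) R, w ^ p * ∫⁻ x in ball (z + y) r, g x ^ p := by
          rw [lintegral_const_mul _ hmeas.lintegral_prod_right',
            lintegral_lintegral_swap hmeas.aemeasurable]
          simp_rw [hball]
          rw [lintegral_const_mul, mul_left_comm]
          simp_rw [← hball]
          exact hmeas.lintegral_prod_left'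
      _ ≤ (V ^ (1 / v - 1 / p)) ^ p * ∫⁻ _ in ball (0 : Euc d) R, N ^ p := by
          gcongr with z
          exact lintegral_ball_rpow_le_morreyNormE_rpow d u hp g (z + y) hr
      _ = (V ^ (1 / v) * N) ^ p := by
          have hexp : 0 ≤ (1 / v - 1 / p) * p :=
            mul_nonneg (sub_nonneg.2 (one_div_le_one_div_of_le hv hvp)) hp.le
          rw [setLIntegral_const, ← hV, ENNReal.mul_rpow_of_nonneg _ _ hp.le,
            ← ENNReal.rpow_mul, ← ENNReal.rpow_mul, mul_comm (N ^ p), ← mul_assoc]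
          congr 1
          nth_rewrite 2 [← ENNReal.rpow_one V]
          rw [← ENNReal.rpow_add_of_nonneg _ _ hexp zero_le_one]
          congr 1
          field_simp
          ring
  rw [univ_inter, ← ENNReal.rpow_le_rpow_iff hp, ENNReal.mul_rpow_of_nonneg _ _ hp.le,
    ← ENNReal.rpow_mul _ (1 / p), one_div_mul_cancel hp.ne', ENNReal.rpow_one]
  exact key

theorem morreyNormE_congr_ae (d : ℕ) (p u : ℝ) (Ω : Set (Euc d)) {f g : Euc d → ℝ≥0∞}
    (h : f =ᵐ[volume] g) : morreyNormE d p u Ω f = morreyNormE d p u Ω g := by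
  have hint (s : Set (Euc d)) : ∫⁻ x in s, f x ^ p = ∫⁻ x in s, g x ^ p :=
    lintegral_congr_ae ((ae_restrict_of_ae h).mono fun x hx => by simp only [hx])
  simp only [morreyNormE, hint]

/-- For `0 < v ≤ p` and `R > 0`, the ball-average operator
`F ↦ (∫_{B(·,R)} |F|^v)^{1/v}` is bounded on `M^u_p(ℝ^d)`. -/
theorem statement5 (d : ℕ) (hd : 0 < d) (p u v R : ℝ)
    (hp : 0 < p) (hpu : p ≤ u) (hv : 0 < v) (hvp : v ≤ p) (hR : 0 < R) :
    ∃ c : ℝ, 0 < c ∧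
      ∀ F : Euc d → ℂ, AEMeasurable F volume →
        morreyNorm d p u Set.univ F < ⊤ →
        morreyNormE d p u Set.univ
            (fun x => (∫⁻ y in Metric.ball x R, (‖F y‖₊ : ℝ≥0∞) ^ v) ^ (1 / v))
          ≤ ENNReal.ofReal c * morreyNorm d p u Set.univ F := by
  have hV0 : 0 < volume (ball (0 : Euc d) R) := measure_ball_pos _ _ hR
  have hVtop : volume (ball (0 : Euc d) R) ≠ ⊤ := measure_ball_lt_top.ne
  have hctop : volume (ball (0 : Euc d) R) ^ (1 / v) ≠ ⊤ :=
    ENNReal.rpow_ne_top_of_nonneg (by positivity) hVtop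
  refine ⟨(volume (ball (0 : Euc d) R) ^ (1 / v)).toReal,
    ENNReal.toReal_pos (ENNReal.rpow_pos hV0 hVtop).ne' hctop, fun F hF _ => ?_⟩
  have hf : AEMeasurable (fun x => (‖F x‖₊ : ℝ≥0∞)) volume := hF.nnnorm.coe_nnreal_ennreal
  have hint (x : Euc d) : ∫⁻ y in ball x R, (‖F y‖₊ : ℝ≥0∞) ^ v =
      ∫⁻ y in ball x R, hf.mk _ y ^ v :=
    lintegral_congr_ae ((ae_restrict_of_ae hf.ae_eq_mk).mono fun y hy => by
      exact congrArg (· ^ v) hy)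
  rw [ENNReal.ofReal_toReal hctop, morreyNorm, morreyNormE_congr_ae d p u univ hf.ae_eq_mk]
  simp only [hint]
  exact morreyNormE_ball_mean_le d R hv hvp hf.measurable_mk
end
end

section
/- Let d, N ∈ ℕ, let Ω ⊆ ℝ^d be a nonempty open set, let C > 0 and T₀ > 0, and let I be a finite index set. Suppose that for every x ∈ Ω and every 0 < t ≤ T₀ we are given a family (p_{i,x,t})_{i ∈ I} of polynomials in 𝒫_{N−1} that is orthonormal with respect to the inner product ⟨f,g⟩_{x,t} := t^{−d} ∫_{B(x,t) ∩ Ω} f(z) · conj(g(z)) dz, whose linear span contains the restriction to B(x,t) ∩ Ω of every polynomial in 𝒫_{N−1}, and which satisfies sup_{y ∈ B(x,t) ∩ Ω} |p_{i,x,t}(y)| ≤ C for all i ∈ I. Set (Π_{x,t} f) := Σ_{i ∈ I} ⟨f, p_{i,x,t}⟩_{x,t} · p_{i,x,t}. Then for every locally integrable f : Ω → ℂ and almost every x ∈ Ω: lim_{t → 0⁺} (Π_{x,t} f)(x) = f(x). -/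
open MeasureTheory ENNReal Set Metric Filter
open scoped NNReal Topology

noncomputable section

/-- A constant `c` is reproduced by the projection onto an orthonormal system whose span contains
it. -/
lemma sum_innerXT_const_mul {d : ℕ} {Ω : Set (Euc d)} {x : Euc d} {t C : ℝ}
    {ι : Type} [Fintype ι] [DecidableEq ι] (q : ι → Euc d → ℂ) (hΩ : MeasurableSet Ω)
    (hq : ∀ i, Continuous (q i))
    (horth : ∀ i j, innerXT d Ω x t (q i) (q j) = if i = j then 1 else 0)
    (hbdd : ∀ i, ∀ y ∈ ball x t ∩ Ω, ‖q i y‖ ≤ C) (hx : x ∈ ball x t ∩ Ω)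
    (c : ℂ) (a : ι → ℂ) (ha : ∀ z ∈ ball x t ∩ Ω, c = ∑ i, a i * q i z) :
    ∑ i, innerXT d Ω x t (fun _ => c) (q i) * q i x = c := by
  have hm : MeasurableSet (ball x t ∩ Ω) := measurableSet_ball.inter hΩ
  have hfin : volume (ball x t ∩ Ω) < ⊤ :=
    (measure_mono inter_subset_left).trans_lt measure_ball_lt_top
  have hint : ∀ i j, IntegrableOn (fun z => q i z * (starRingEnd ℂ) (q j z))
      (ball x t ∩ Ω) := by
    intro i j
    refine Measure.integrableOn_of_bounded (M := C * C) hfin.ne ?_ ?_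
    · exact ((hq i).mul (Complex.continuous_conj.comp (hq j))).aestronglyMeasurable
    · refine ae_restrict_of_forall_mem hm fun z hz => ?_
      rw [norm_mul, RCLike.norm_conj]
      exact mul_le_mul (hbdd i z hz) (hbdd j z hz) (norm_nonneg _)
        ((norm_nonneg _).trans (hbdd i z hz))
  have hcoef : ∀ j, innerXT d Ω x t (fun _ => c) (q j) = a j := by
    intro j
    have h1 : innerXT d Ω x t (fun _ => c) (q j) = ∑ i, a i * innerXT d Ω x t (q i) (q j) := by
      unfold innerXT
      rw [setIntegral_congr_fun (g := fun z => ∑ i, a i * (q i z * (starRingEnd ℂ) (q j z))) hm]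
      · rw [integral_finsetSum _ fun i _ => (hint i j).const_mul (a i), Finset.mul_sum]
        refine Finset.sum_congr rfl fun i _ => ?_
        rw [integral_const_mul]
        ring
      · intro z hz
        simp only
        rw [ha z hz, Finset.sum_mul]
        exact Finset.sum_congr rfl fun i _ => by ring
    rw [h1]
    simp [horth]
  simp only [hcoef]
  exact (ha x hx).symm

lemma continuous_of_mem_polyFuns {d N : ℕ} {P : Euc d → ℂ} (hP : P ∈ polyFuns d N) :
    Continuous P := by
  obtain ⟨Q, -, hQ⟩ := hP
  rw [funext hQ]
  exact (MvPolynomial.continuous_eval Q).comp (by fun_prop)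

lemma const_mem_polyFuns {d N : ℕ} (hN : 0 < N) (c : ℂ) : (fun _ => c) ∈ polyFuns d N :=
  ⟨MvPolynomial.C c, by simpa using hN, fun x => by simp⟩

/-- The value at `x` of the projection of `f` differs from `f x` by at most a multiple of the
mean oscillation of `f` about `f x`. -/
lemma norm_sum_innerXT_mul_sub_le {d : ℕ} {Ω : Set (Euc d)} {x : Euc d} {t C : ℝ} (ht : 0 < t)
    {ι : Type} [Fintype ι] [DecidableEq ι] (q : ι → Euc d → ℂ) (hΩ : MeasurableSet Ω)
    (hq : ∀ i, Continuous (q i))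
    (horth : ∀ i j, innerXT d Ω x t (q i) (q j) = if i = j then 1 else 0)
    (hbdd : ∀ i, ∀ y ∈ ball x t ∩ Ω, ‖q i y‖ ≤ C) (hx : x ∈ Ω)
    (f : Euc d → ℂ) (hf : IntegrableOn f (closedBall x t))
    (a : ι → ℂ) (ha : ∀ z ∈ ball x t ∩ Ω, f x = ∑ i, a i * q i z) :
    ‖∑ i, innerXT d Ω x t f (q i) * q i x - f x‖ ≤
      (Fintype.card ι * (C * C) * volume.real (ball (0 : Euc d) 1)) *
        ⨍ y in closedBall x t, ‖f y - f x‖ := by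
  have hxm : x ∈ ball x t ∩ Ω := ⟨mem_ball_self ht, hx⟩
  have hm : MeasurableSet (ball x t ∩ Ω) := measurableSet_ball.inter hΩ
  have hsub : ball x t ∩ Ω ⊆ closedBall x t := inter_subset_left.trans ball_subset_closedBall
  have hfin : volume (closedBall x t) ≠ ⊤ := measure_closedBall_lt_top.ne
  have hg : IntegrableOn (fun y => f y - f x) (closedBall x t) :=
    hf.sub (integrableOn_const hfin)
  have hmul : ∀ (g : Euc d → ℂ), IntegrableOn g (closedBall x t) → ∀ i,
      IntegrableOn (fun z => g z * (starRingEnd ℂ) (q i z)) (ball x t ∩ Ω) := by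
    intro g hg i
    refine (hg.mono_set hsub).mul_bdd (c := C) ?_ ?_
    · exact (Complex.continuous_conj.comp (hq i)).aestronglyMeasurable
    · refine ae_restrict_of_forall_mem hm fun z hz => ?_
      rw [RCLike.norm_conj]
      exact hbdd i z hz
  have hdiff : ∀ i, innerXT d Ω x t f (q i) - innerXT d Ω x t (fun _ => f x) (q i) =
      innerXT d Ω x t (fun y => f y - f x) (q i) := by
    intro i
    unfold innerXT
    rw [← mul_sub, ← integral_sub (hmul f hf i) (hmul _ (integrableOn_const hfin) i)]
    simp only [sub_mul]
  have hkey : ∀ i, ‖innerXT d Ω x t (fun y => f y - f x) (q i) * q i x‖ ≤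
      C * C * volume.real (ball (0 : Euc d) 1) * ⨍ y in closedBall x t, ‖f y - f x‖ := by
    intro i
    have hC : 0 ≤ C := (norm_nonneg _).trans (hbdd i x hxm)
    have htd : 0 < t ^ d := pow_pos ht d
    have hvol : 0 < volume.real (ball (0 : Euc d) 1) :=
      ENNReal.toReal_pos (measure_ball_pos _ _ one_pos).ne' measure_ball_lt_top.ne
    have hI : ‖∫ z in ball x t ∩ Ω, (f z - f x) * (starRingEnd ℂ) (q i z)‖ ≤
        C * ∫ z in closedBall x t, ‖f z - f x‖ := by
      calc _ ≤ ∫ z in ball x t ∩ Ω, ‖(f z - f x) * (starRingEnd ℂ) (q i z)‖ :=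
            norm_integral_le_integral_norm _
        _ ≤ ∫ z in ball x t ∩ Ω, C * ‖f z - f x‖ := by
            refine setIntegral_mono_on (hmul _ hg i).norm
              ((hg.mono_set hsub).norm.const_mul C) hm fun z hz => ?_
            rw [norm_mul, RCLike.norm_conj, mul_comm]
            exact mul_le_mul_of_nonneg_right (hbdd i z hz) (norm_nonneg _)
        _ = C * ∫ z in ball x t ∩ Ω, ‖f z - f x‖ := integral_const_mul _ _
        _ ≤ C * ∫ z in closedBall x t, ‖f z - f x‖ :=
            mul_le_mul_of_nonneg_left (setIntegral_mono_set hg.norm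
              (ae_of_all _ fun _ => norm_nonneg _) hsub.eventuallyLE) hC
    have havg : (⨍ y in closedBall x t, ‖f y - f x‖) =
        (t ^ d * volume.real (ball (0 : Euc d) 1))⁻¹ * ∫ z in closedBall x t, ‖f z - f x‖ := by
      rw [setAverage_eq, Measure.addHaar_real_closedBall _ _ ht.le, finrank_euclideanSpace,
        Fintype.card_fin, smul_eq_mul]
    rw [norm_mul]
    unfold innerXT
    rw [norm_mul, Complex.norm_real, Real.norm_of_nonneg (by positivity), Real.rpow_neg ht.le,
      Real.rpow_natCast, havg]
    calc _ ≤ (t ^ d)⁻¹ * (C * ∫ z in closedBall x t, ‖f z - f x‖) * C := by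
          have := hbdd i x hxm
          gcongr
      _ = _ := by field_simp
  have hconst := sum_innerXT_const_mul q hΩ hq horth hbdd hxm (f x) a ha
  calc _ = ‖∑ i, innerXT d Ω x t (fun y => f y - f x) (q i) * q i x‖ := by
        simp only [← hdiff, sub_mul, Finset.sum_sub_distrib, hconst]
    _ ≤ ∑ i, ‖innerXT d Ω x t (fun y => f y - f x) (q i) * q i x‖ := norm_sum_le _ _
    _ ≤ ∑ _i : ι, C * C * volume.real (ball (0 : Euc d) 1) *
          ⨍ y in closedBall x t, ‖f y - f x‖ := Finset.sum_le_sum fun i _ => hkey i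
    _ = _ := by
        rw [Finset.sum_const, Finset.card_univ, nsmul_eq_mul]
        ring

lemma MemLvLoc.integrableOn {d : ℕ} {Ω K : Set (Euc d)} {f : Euc d → ℂ}
    (hf : MemLvLoc d 1 Ω f) (hK : IsCompact K) (hKΩ : K ⊆ Ω) : IntegrableOn f K := by
  refine ⟨(hf.1.mono_measure (Measure.restrict_mono_set _ hKΩ)).aestronglyMeasurable, ?_⟩
  simpa [HasFiniteIntegral, enorm_eq_nnnorm] using hf.2 K hK hKΩ

/-- Lebesgue differentiation for locally integrable functions on an open subset of `ℝ^d`. -/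
lemma MemLvLoc.ae_tendsto_average_norm_sub {d : ℕ} {Ω : Set (Euc d)} (hΩ : IsOpen Ω)
    {f : Euc d → ℂ} (hf : MemLvLoc d 1 Ω f) :
    ∀ᵐ x ∂volume.restrict Ω,
      Tendsto (fun t : ℝ => ⨍ y in closedBall x t, ‖f y - f x‖) (𝓝[>] 0) (𝓝 0) := by
  rw [ae_restrict_iff' hΩ.measurableSet, ae_iff]
  refine measure_null_of_locally_null _ fun x hx => ?_
  simp only [mem_ofPred_eq, Classical.not_imp] at hx
  obtain ⟨r, hr, hrΩ⟩ := nhds_basis_closedBall.mem_iff.1 (hΩ.mem_nhds hx.1)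
  refine ⟨_, inter_mem_nhdsWithin _ (ball_mem_nhds x hr), ?_⟩
  have hint : Integrable ((closedBall x r).indicator f) :=
    (hf.integrableOn (isCompact_closedBall x r) hrΩ).integrable_indicator
      measurableSet_closedBall
  have hae := IsUnifLocDoublingMeasure.ae_tendsto_average_norm_sub volume
    hint.locallyIntegrable 1
  refine measure_mono_null ?_ (ae_iff.1 hae)
  rintro y ⟨hy, hyr⟩ h
  simp only [mem_ofPred_eq, Classical.not_imp] at hy
  refine hy.2 ((h (fun _ => y) (fun t : ℝ => t) tendsto_id ?_).congr' ?_)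
  · filter_upwards [self_mem_nhdsWithin] with t ht
    exact mem_closedBall_self (by simpa using (mem_Ioi.1 ht).le)
  · have hpos : 0 < r - dist y x := sub_pos.2 hyr
    filter_upwards [Ioo_mem_nhdsGT hpos] with t ht
    have hsub : closedBall y t ⊆ closedBall x r :=
      closedBall_subset_closedBall' (by linarith [ht.2])
    rw [setAverage_eq, setAverage_eq]
    congr 1
    refine setIntegral_congr_fun measurableSet_closedBall fun z hz => ?_
    rw [indicator_of_mem (hsub hz), indicator_of_mem (ball_subset_closedBall hyr)]

open scoped Classical in
/-- Limit property of the projections onto quasi-optimal polynomials: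
for a.e. `x ∈ Ω`, `(Π_{x,t} f)(x) → f(x)` as `t → 0⁺`. -/
theorem statement9 (d N : ℕ) (hd : 0 < d) (hN : 0 < N)
    (Ω : Set (Euc d)) (hΩ : IsOpen Ω) (hne : Ω.Nonempty)
    (C T₀ : ℝ) (hC : 0 < C) (hT₀ : 0 < T₀)
    {ι : Type} [Fintype ι]
    (p : Euc d → ℝ → ι → Euc d → ℂ)
    (hpoly : ∀ x ∈ Ω, ∀ t : ℝ, 0 < t → t ≤ T₀ → ∀ i, p x t i ∈ polyFuns d N)
    (horth : ∀ x ∈ Ω, ∀ t : ℝ, 0 < t → t ≤ T₀ → ∀ i j,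
      innerXT d Ω x t (p x t i) (p x t j) = if i = j then 1 else 0)
    (hspan : ∀ x ∈ Ω, ∀ t : ℝ, 0 < t → t ≤ T₀ → ∀ Q ∈ polyFuns d N,
      ∃ a : ι → ℂ, ∀ z ∈ Metric.ball x t ∩ Ω, Q z = ∑ i, a i * p x t i z)
    (hbdd : ∀ x ∈ Ω, ∀ t : ℝ, 0 < t → t ≤ T₀ → ∀ i,
      ∀ y ∈ Metric.ball x t ∩ Ω, ‖p x t i y‖ ≤ C) :
    ∀ f : Euc d → ℂ, MemLvLoc d 1 Ω f →
      ∀ᵐ x ∂volume.restrict Ω,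
        Filter.Tendsto (fun t : ℝ => ∑ i, innerXT d Ω x t f (p x t i) * p x t i x)
          (nhdsWithin (0 : ℝ) (Set.Ioi 0)) (nhds (f x)) := by
  intro f hf
  filter_upwards [hf.ae_tendsto_average_norm_sub hΩ, ae_restrict_mem hΩ.measurableSet]
    with x hlim hx
  obtain ⟨r, hr, hrΩ⟩ := nhds_basis_closedBall.mem_iff.1 (hΩ.mem_nhds hx)
  rw [tendsto_iff_norm_sub_tendsto_zero]
  have hlim' := hlim.const_mul
    (Fintype.card ι * (C * C) * volume.real (ball (0 : Euc d) 1))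
  rw [mul_zero] at hlim'
  refine squeeze_zero' (Eventually.of_forall fun _ => norm_nonneg _) ?_ hlim'
  filter_upwards [Ioo_mem_nhdsGT (lt_min hr hT₀)] with t ht
  have htr : t ≤ r := ht.2.le.trans (min_le_left _ _)
  have htT : t ≤ T₀ := ht.2.le.trans (min_le_right _ _)
  obtain ⟨a, ha⟩ := hspan x hx t ht.1 htT _ (const_mem_polyFuns hN (f x))
  exact norm_sum_innerXT_mul_sub_le ht.1 (p x t) hΩ.measurableSet
    (fun i => continuous_of_mem_polyFuns (hpoly x hx t ht.1 htT i))
    (horth x hx t ht.1 htT) (hbdd x hx t ht.1 htT) hx f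
    (hf.integrableOn (isCompact_closedBall x t) ((closedBall_subset_closedBall htr).trans hrΩ))
    a ha
end
end
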